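/- Let G be a 2-connected simple graph on [N] with an edge e = uv such that deg_G(u) = 2, and let c = (c_1,…,c_N) be a D(G)-draconian sequence. If c is not D(G∖e)-draconian, then either (c_u ≥ 1 and the length-(N+1) sequence obtained from c by decreasing c_u by 1 and appending 2 is D(G:e)-draconian) or (the sequence obtained from c by increasing c_u by 1 and appending 0 is D(G:e)-draconian). If c is D(G∖e)-draconian, then either (c_u ≥ 1 and the sequence obtained from c by decreasing c_u by 1 and appending 2 is D(G:e)-draconian) or (the sequence obtained from c by increasing c_v by 1 and appending 0 is D(G:e)-draconian). -/

import Mathlib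

open Finset

attribute [local instance] Classical.propDecidable

/-- The set of neighbors of `i` in `G`, as a `Finset`. -/
noncomputable def nbr {N : ℕ} (G : SimpleGraph (Fin N)) (i : Fin N) : Finset (Fin N) :=
  Finset.univ.filter (fun j => G.Adj i j)

/-- `(a 1, …, a N)` is a `D(G)`-draconian sequence: the entries sum to `N - 1` and for
every nonempty `S ⊆ [N]` one has `∑_{i ∈ S} a i < |S ∪ ⋃_{i ∈ S} N_G(i)|`. -/
def draconian {N : ℕ} (G : SimpleGraph (Fin N)) (a : Fin N → ℕ) : Prop :=
  (∑ i, a i) = N - 1 ∧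
  ∀ S : Finset (Fin N), S.Nonempty →
    (∑ i ∈ S, a i) < (S ∪ S.biUnion (fun i => nbr G i)).card

/-- The subdivision `G : e` of the edge `e = uv` of `G`: the graph on `[N+1]` with edge
set `(E(G) ∖ {uv}) ∪ {u(N+1), v(N+1)}`. -/
def subdiv {N : ℕ} (G : SimpleGraph (Fin N)) (u v : Fin N) : SimpleGraph (Fin (N + 1)) :=
  SimpleGraph.fromRel (fun i j =>
    (∃ a b : Fin N, i = a.castSucc ∧ j = b.castSucc ∧ G.Adj a b ∧
      ¬(a = u ∧ b = v) ∧ ¬(a = v ∧ b = u))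
    ∨ (i = u.castSucc ∧ j = Fin.last N) ∨ (i = v.castSucc ∧ j = Fin.last N))

/-- The graph `G △ e` for an edge `e = uv` of `G`: the graph on `[N+1]` with edge set
`E(G) ∪ {u(N+1), v(N+1)}`. -/
def triExt {N : ℕ} (G : SimpleGraph (Fin N)) (u v : Fin N) : SimpleGraph (Fin (N + 1)) :=
  SimpleGraph.fromRel (fun i j =>
    (∃ a b : Fin N, i = a.castSucc ∧ j = b.castSucc ∧ G.Adj a b)
    ∨ (i = u.castSucc ∧ j = Fin.last N) ∨ (i = v.castSucc ∧ j = Fin.last N))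

/-- A graph on `[N]` is `2`-connected if it has at least `3` vertices, is connected, and
remains connected after deleting any single vertex. -/
def TwoConnected {N : ℕ} (G : SimpleGraph (Fin N)) : Prop :=
  3 ≤ N ∧ G.Connected ∧
    ∀ v : Fin N, (G.comap (fun u : {w : Fin N // w ≠ v} => (u : Fin N))).Connected

/-- The closed neighborhood `S ∪ ⋃_{i ∈ S} N_G(i)` of a vertex set `S`. -/
noncomputable def closedNbr {N : ℕ} (G : SimpleGraph (Fin N)) (S : Finset (Fin N)) :
    Finset (Fin N) :=
  S ∪ S.biUnion (fun i => nbr G i)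

lemma mem_closedNbr {N : ℕ} {G : SimpleGraph (Fin N)} {S : Finset (Fin N)} {x : Fin N} :
    x ∈ closedNbr G S ↔ x ∈ S ∨ ∃ y ∈ S, G.Adj y x := by
  simp [closedNbr, nbr]

lemma closedNbr_union {N : ℕ} (G : SimpleGraph (Fin N)) (S T : Finset (Fin N)) :
    closedNbr G (S ∪ T) = closedNbr G S ∪ closedNbr G T := by
  ext x
  simp only [mem_closedNbr, Finset.mem_union]
  grind

lemma closedNbr_mono {N : ℕ} (G : SimpleGraph (Fin N)) {S T : Finset (Fin N)} (h : S ⊆ T) :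
    closedNbr G S ⊆ closedNbr G T := by
  intro x
  simp only [mem_closedNbr]
  grind

lemma sum_lt_card_closedNbr {N : ℕ} {G : SimpleGraph (Fin N)} {c : Fin N → ℕ}
    (hc : draconian G c) {S : Finset (Fin N)} (hS : S.Nonempty) :
    ∑ i ∈ S, c i < (closedNbr G S).card :=
  hc.2 S hS

lemma deleteEdges_singleton_adj {N : ℕ} {G : SimpleGraph (Fin N)} {u v a b : Fin N} :
    (G.deleteEdges {s(u, v)}).Adj a b ↔
      G.Adj a b ∧ ¬(a = u ∧ b = v) ∧ ¬(a = v ∧ b = u) := by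
  rw [SimpleGraph.deleteEdges_adj, Set.mem_singleton_iff, Sym2.eq_iff]
  tauto

lemma closedNbr_deleteEdges_subset {N : ℕ} (G : SimpleGraph (Fin N)) (u v : Fin N)
    (S : Finset (Fin N)) : closedNbr (G.deleteEdges {s(u, v)}) S ⊆ closedNbr G S := by
  intro x
  simp only [mem_closedNbr, deleteEdges_singleton_adj]
  grind

lemma closedNbr_subset_deleteEdges_union {N : ℕ} (G : SimpleGraph (Fin N)) (u v : Fin N)
    (S : Finset (Fin N)) :
    closedNbr G S ⊆ closedNbr (G.deleteEdges {s(u, v)}) S ∪ {u, v} := by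
  intro x
  simp only [mem_closedNbr, deleteEdges_singleton_adj, Finset.mem_union, Finset.mem_insert,
    Finset.mem_singleton]
  grind

lemma closedNbr_subset_insert_left {N : ℕ} (G : SimpleGraph (Fin N)) {u : Fin N} (v : Fin N)
    {S : Finset (Fin N)} (hu : u ∈ S) :
    closedNbr G S ⊆ insert v (closedNbr (G.deleteEdges {s(u, v)}) S) := by
  intro x
  simp only [mem_closedNbr, deleteEdges_singleton_adj, Finset.mem_insert]
  grind

lemma closedNbr_subset_insert_right {N : ℕ} (G : SimpleGraph (Fin N)) (u : Fin N) {v : Fin N}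
    {S : Finset (Fin N)} (hv : v ∈ S) :
    closedNbr G S ⊆ insert u (closedNbr (G.deleteEdges {s(u, v)}) S) := by
  intro x
  simp only [mem_closedNbr, deleteEdges_singleton_adj, Finset.mem_insert]
  grind

lemma closedNbr_subset_deleteEdges {N : ℕ} (G : SimpleGraph (Fin N)) {u v : Fin N}
    {S : Finset (Fin N)} (hu : u ∉ S) (hv : v ∉ S) :
    closedNbr G S ⊆ closedNbr (G.deleteEdges {s(u, v)}) S := by
  intro x
  simp only [mem_closedNbr, deleteEdges_singleton_adj]
  grind

/-- Deleting the edge `uv` costs at most one element of a closed neighborhood, and only if the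
vertex set meets `{u, v}`. -/
lemma card_closedNbr_le {N : ℕ} (G : SimpleGraph (Fin N)) (u v : Fin N) (S : Finset (Fin N)) :
    (closedNbr G S).card ≤
      (closedNbr (G.deleteEdges {s(u, v)}) S).card + if u ∈ S ∨ v ∈ S then 1 else 0 := by
  by_cases hu : u ∈ S
  · have h := (Finset.card_le_card (closedNbr_subset_insert_left G v hu)).trans
      (Finset.card_insert_le _ _)
    simpa [hu] using h
  by_cases hv : v ∈ S
  · have h := (Finset.card_le_card (closedNbr_subset_insert_right G u hv)).trans
      (Finset.card_insert_le _ _)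
    simpa [hv] using h
  · simpa [hu, hv] using Finset.card_le_card (closedNbr_subset_deleteEdges G hu hv)

/-- The part of a vertex set of `[N + 1]` lying in `[N]`. -/
noncomputable def castSuccPart {N : ℕ} (T : Finset (Fin (N + 1))) : Finset (Fin N) :=
  Finset.univ.filter (fun i => i.castSucc ∈ T)

lemma mem_castSuccPart {N : ℕ} {T : Finset (Fin (N + 1))} {i : Fin N} :
    i ∈ castSuccPart T ↔ i.castSucc ∈ T := by
  simp [castSuccPart]

lemma sum_eq_sum_castSuccPart {N : ℕ} (f : Fin (N + 1) → ℕ) (T : Finset (Fin (N + 1))) :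
    ∑ i ∈ T, f i =
      ∑ i ∈ castSuccPart T, f i.castSucc + if Fin.last N ∈ T then f (Fin.last N) else 0 := by
  have h : ∑ i ∈ T, f i = ∑ i, if i ∈ T then f i else 0 := by simp
  rw [h, Fin.sum_univ_castSucc, castSuccPart, Finset.sum_filter]

lemma card_eq_card_castSuccPart {N : ℕ} (T : Finset (Fin (N + 1))) :
    T.card = (castSuccPart T).card + if Fin.last N ∈ T then 1 else 0 := by
  simpa using sum_eq_sum_castSuccPart (fun _ => 1) T

lemma subdiv_adj_castSucc {N : ℕ} {G : SimpleGraph (Fin N)} {u v a b : Fin N} :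
    (subdiv G u v).Adj a.castSucc b.castSucc ↔ (G.deleteEdges {s(u, v)}).Adj a b := by
  rw [deleteEdges_singleton_adj]
  simp only [subdiv, SimpleGraph.fromRel_adj, Fin.castSucc_inj, Fin.castSucc_ne_last,
    and_false, or_false, ne_eq]
  constructor
  · rintro ⟨-, ⟨x, y, rfl, rfl, h⟩ | ⟨x, y, rfl, rfl, h, h'⟩⟩
    · exact h
    · exact ⟨h.symm, by tauto⟩
  · rintro ⟨h, h'⟩
    exact ⟨h.ne, Or.inl ⟨a, b, rfl, rfl, h, h'⟩⟩

lemma subdiv_adj_last {N : ℕ} {G : SimpleGraph (Fin N)} {u v a : Fin N} :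
    (subdiv G u v).Adj a.castSucc (Fin.last N) ↔ a = u ∨ a = v := by
  simp [subdiv, SimpleGraph.fromRel_adj, (Fin.castSucc_ne_last _).symm]

lemma castSuccPart_closedNbr_subdiv {N : ℕ} (G : SimpleGraph (Fin N)) (u v : Fin N)
    (T : Finset (Fin (N + 1))) :
    castSuccPart (closedNbr (subdiv G u v) T) =
      closedNbr (G.deleteEdges {s(u, v)}) (castSuccPart T) ∪
        if Fin.last N ∈ T then {u, v} else ∅ := by
  ext x
  have h : ∀ a : Fin N, (subdiv G u v).Adj (Fin.last N) a.castSucc ↔ a = u ∨ a = v :=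
    fun a => (SimpleGraph.adj_comm _ _ _).trans subdiv_adj_last
  by_cases hT : Fin.last N ∈ T
  · simp [mem_castSuccPart, mem_closedNbr, Fin.exists_fin_succ', subdiv_adj_castSucc, h, hT,
      or_assoc, or_comm, or_left_comm]
  · simp [mem_castSuccPart, mem_closedNbr, Fin.exists_fin_succ', subdiv_adj_castSucc, hT]

lemma last_mem_closedNbr_subdiv {N : ℕ} (G : SimpleGraph (Fin N)) (u v : Fin N)
    (T : Finset (Fin (N + 1))) :
    Fin.last N ∈ closedNbr (subdiv G u v) T ↔
      Fin.last N ∈ T ∨ u ∈ castSuccPart T ∨ v ∈ castSuccPart T := by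
  simp only [mem_castSuccPart, mem_closedNbr, Fin.exists_fin_succ', subdiv_adj_last,
    SimpleGraph.irrefl, and_false, or_false]
  grind

/-- A criterion for a sequence on the subdivided graph to be draconian, separating the vertex
sets that avoid the new vertex from those that contain it. -/
lemma draconian_subdiv {N : ℕ} {G : SimpleGraph (Fin N)} {u v : Fin N} {a : Fin N → ℕ} {x : ℕ}
    (hsum : ∑ i, a i + x = N)
    (hold : ∀ S : Finset (Fin N), S.Nonempty → ∑ i ∈ S, a i <
      (closedNbr (G.deleteEdges {s(u, v)}) S).card + if u ∈ S ∨ v ∈ S then 1 else 0)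
    (hnew : ∀ S : Finset (Fin N),
      ∑ i ∈ S, a i + x < (closedNbr (G.deleteEdges {s(u, v)}) S ∪ {u, v}).card + 1) :
    draconian (subdiv G u v) (Fin.snoc a x) := by
  refine ⟨by simpa [Fin.sum_univ_castSucc] using hsum, fun T hT => ?_⟩
  change _ < (closedNbr (subdiv G u v) T).card
  rw [card_eq_card_castSuccPart, castSuccPart_closedNbr_subdiv, sum_eq_sum_castSuccPart]
  simp only [last_mem_closedNbr_subdiv, Fin.snoc_castSucc, Fin.snoc_last]
  by_cases h : Fin.last N ∈ T
  · simpa [h] using hnew (castSuccPart T)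
  · have hne : (castSuccPart T).Nonempty := by
      obtain ⟨t, ht⟩ := hT
      induction t using Fin.lastCases with
      | last => exact absurd ht h
      | cast i => exact ⟨i, mem_castSuccPart.2 ht⟩
    simpa [h] using hold _ hne

lemma sum_update_add {N : ℕ} (c : Fin N → ℕ) (z : Fin N) (b : ℕ) (S : Finset (Fin N)) :
    ∑ i ∈ S, Function.update c z b i + (if z ∈ S then c z else 0) =
      ∑ i ∈ S, c i + if z ∈ S then b else 0 := by
  by_cases h : z ∈ S
  · have herase : ∑ i ∈ S.erase z, Function.update c z b i = ∑ i ∈ S.erase z, c i :=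
      Finset.sum_congr rfl fun i hi => Function.update_of_ne (Finset.ne_of_mem_erase hi) b c
    rw [← Finset.add_sum_erase S _ h, ← Finset.add_sum_erase S c h, herase]
    simp only [Function.update_self, h, if_true]
    omega
  · simp only [h, if_false, add_zero]
    exact Finset.sum_congr rfl fun i hi => Function.update_of_ne (by grind) b c

lemma draconian_subdiv_increase {N : ℕ} {G : SimpleGraph (Fin N)} {u v z : Fin N}
    {c : Fin N → ℕ} (hc : draconian G c) (hz : z = u ∨ z = v)
    (h : ∀ S : Finset (Fin N), z ∈ S →
      ∑ i ∈ S, c i < (closedNbr (G.deleteEdges {s(u, v)}) S).card) :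
    draconian (subdiv G u v) (Fin.snoc (Function.update c z (c z + 1)) 0) := by
  have hN := z.pos
  have key : ∀ S : Finset (Fin N), S.Nonempty → ∑ i ∈ S, Function.update c z (c z + 1) i <
      (closedNbr (G.deleteEdges {s(u, v)}) S).card + if u ∈ S ∨ v ∈ S then 1 else 0 := by
    intro S hS
    have hs := sum_update_add c z (c z + 1) S
    by_cases hzS : z ∈ S
    · have huv : u ∈ S ∨ v ∈ S := by rcases hz with rfl | rfl <;> tauto
      have := h S hzS
      simp only [hzS, huv, if_true] at hs ⊢
      omega
    · have h1 := card_closedNbr_le G u v S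
      have h2 := sum_lt_card_closedNbr hc hS
      simp only [hzS, if_false] at hs
      omega
  refine draconian_subdiv ?_ key fun S => ?_
  · have hs := sum_update_add c z (c z + 1) Finset.univ
    have := hc.1
    simp only [Finset.mem_univ, if_true] at hs
    omega
  · rcases S.eq_empty_or_nonempty with rfl | hS
    · simp
    · have h1 := key S hS
      have h2 := Finset.card_le_card (Finset.subset_union_left
        (s₁ := closedNbr (G.deleteEdges {s(u, v)}) S) (s₂ := {u, v}))
      split_ifs at h1 <;> omega

lemma draconian_subdiv_decrease {N : ℕ} {G : SimpleGraph (Fin N)} {u v : Fin N}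
    (he : G.Adj u v) {c : Fin N → ℕ} (hc : draconian G c) {S : Finset (Fin N)} (huS : u ∈ S)
    (hS : (closedNbr (G.deleteEdges {s(u, v)}) S).card ≤ ∑ i ∈ S, c i) :
    1 ≤ c u ∧ draconian (subdiv G u v) (Fin.snoc (Function.update c u (c u - 1)) 2) := by
  have hN := u.pos
  have hSlt := sum_lt_card_closedNbr hc ⟨u, huS⟩
  have hcard := card_closedNbr_le G u v S
  simp only [huS, true_or, if_true] at hcard
  have hvS : v ∉ closedNbr (G.deleteEdges {s(u, v)}) S := by
    intro hv
    have hsub := closedNbr_subset_insert_left G v huS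
    rw [Finset.insert_eq_of_mem hv] at hsub
    have := Finset.card_le_card hsub
    omega
  have hErase : closedNbr G (S.erase u) ⊆ closedNbr (G.deleteEdges {s(u, v)}) S := by
    intro x hx
    rw [mem_closedNbr] at hx hvS ⊢
    simp only [deleteEdges_singleton_adj] at hvS ⊢
    grind
  have hcu : 1 ≤ c u := by
    by_contra hcu
    have hsum := Finset.add_sum_erase S c huS
    have hle := Finset.card_le_card hErase
    rcases (S.erase u).eq_empty_or_nonempty with h0 | h0
    · rw [h0, Finset.sum_empty] at hsum
      have : 0 < (closedNbr (G.deleteEdges {s(u, v)}) S).card :=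
        Finset.card_pos.2 ⟨u, mem_closedNbr.2 (Or.inl huS)⟩
      omega
    · have := sum_lt_card_closedNbr hc h0
      omega
  refine ⟨hcu, draconian_subdiv ?_ (fun T hT => ?_) fun T => ?_⟩
  · have hs := sum_update_add c u (c u - 1) Finset.univ
    have := hc.1
    simp only [Finset.mem_univ, if_true] at hs
    have := Finset.single_le_sum (f := c) (fun i _ => Nat.zero_le _) (Finset.mem_univ u)
    omega
  · have hs := sum_update_add c u (c u - 1) T
    have h1 := card_closedNbr_le G u v T
    have h2 := sum_lt_card_closedNbr hc hT
    split_ifs at hs h1 ⊢ <;> omega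
  · have hs := sum_update_add c u (c u - 1) T
    have hsub : closedNbr G T ∪ {u, v} ⊆ closedNbr (G.deleteEdges {s(u, v)}) T ∪ {u, v} :=
      Finset.union_subset (closedNbr_subset_deleteEdges_union G u v T)
        Finset.subset_union_right
    have hle := Finset.card_le_card hsub
    have hle' := Finset.card_le_card
      (Finset.subset_union_left (s₁ := closedNbr G T) (s₂ := {u, v}))
    rcases T.eq_empty_or_nonempty with rfl | hT
    · have : ({u, v} : Finset (Fin N)).card = 2 := Finset.card_pair he.ne
      simp [closedNbr, this]
    have hTlt := sum_lt_card_closedNbr hc hT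
    by_cases huT : u ∈ T
    · simp only [huT, if_true] at hs
      omega
    simp only [huT, if_false] at hs
    by_cases huv : {u, v} ⊆ closedNbr G T
    · suffices ∑ i ∈ T, c i + 1 < (closedNbr G T).card by omega
      by_contra htight
      have hcu' := sum_lt_card_closedNbr hc (S := S ∪ T) ⟨u, Finset.mem_union_left _ huS⟩
      rw [closedNbr_union] at hcu'
      have e1 := Finset.card_union_add_card_inter (closedNbr G S) (closedNbr G T)
      have e2 := Finset.sum_union_inter (s₁ := S) (s₂ := T) (f := c)
      have hpair : {u, v} ⊆ closedNbr G S ∩ closedNbr G T := by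
        refine Finset.subset_inter ?_ huv
        intro x hx
        rw [mem_closedNbr]
        simp only [Finset.mem_insert, Finset.mem_singleton] at hx
        rcases hx with rfl | rfl
        · exact Or.inl huS
        · exact Or.inr ⟨u, huS, he⟩
      rcases (S ∩ T).eq_empty_or_nonempty with h0 | h0
      · have h2 := Finset.card_le_card hpair
        rw [Finset.card_pair he.ne] at h2
        rw [h0, Finset.sum_empty] at e2
        omega
      · have h1 := sum_lt_card_closedNbr hc h0
        have hv : v ∉ closedNbr G (S ∩ T) := fun hv =>
          hvS (hErase (closedNbr_mono G (by grind) hv))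
        have hss : closedNbr G (S ∩ T) ⊂ closedNbr G S ∩ closedNbr G T := by
          refine (Finset.ssubset_iff_of_subset (Finset.subset_inter
            (closedNbr_mono G Finset.inter_subset_left)
            (closedNbr_mono G Finset.inter_subset_right))).2 ⟨v, hpair (by simp), hv⟩
        have := Finset.card_lt_card hss
        omega
    · have hss : closedNbr G T ⊂ closedNbr G T ∪ {u, v} :=
        Finset.ssubset_iff_subset_ne.2 ⟨Finset.subset_union_left, fun h =>
          huv (Finset.union_eq_left.1 h.symm)⟩
      have := Finset.card_lt_card hss
      omega

/-- Let `G` be `2`-connected on `[N]` with an edge `e = uv` such that `deg_G(u) = 2`, and let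
`c` be `D(G)`-draconian. If `c` is not `D(G∖e)`-draconian, then either (`c u ≥ 1` and the
sequence obtained from `c` by decreasing `c u` by `1` and appending `2` is `D(G:e)`-draconian)
or (the sequence obtained by increasing `c u` by `1` and appending `0` is `D(G:e)`-draconian).
If `c` is `D(G∖e)`-draconian, then either (`c u ≥ 1` and decreasing `c u` by `1` and appending
`2` gives a `D(G:e)`-draconian sequence) or (increasing `c v` by `1` and appending `0` gives a
`D(G:e)`-draconian sequence). -/
theorem draconian_gamma_subdiv {N : ℕ} (G : SimpleGraph (Fin N)) (h2 : TwoConnected G)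
    (u v : Fin N) (he : G.Adj u v) (hdeg : (nbr G u).card = 2)
    (c : Fin N → ℕ) (hc : draconian G c) :
    (¬ draconian (G.deleteEdges {s(u, v)}) c →
      (1 ≤ c u ∧ draconian (subdiv G u v) (Fin.snoc (Function.update c u (c u - 1)) 2)) ∨
        draconian (subdiv G u v) (Fin.snoc (Function.update c u (c u + 1)) 0)) ∧
    (draconian (G.deleteEdges {s(u, v)}) c →
      (1 ≤ c u ∧ draconian (subdiv G u v) (Fin.snoc (Function.update c u (c u - 1)) 2)) ∨
        draconian (subdiv G u v) (Fin.snoc (Function.update c v (c v + 1)) 0)) := by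
  refine ⟨fun _ => ?_, fun h =>
    Or.inr (draconian_subdiv_increase hc (Or.inr rfl) fun S hS => h.2 S ⟨v, hS⟩)⟩
  by_cases h : ∀ S : Finset (Fin N), u ∈ S →
      ∑ i ∈ S, c i < (closedNbr (G.deleteEdges {s(u, v)}) S).card
  · exact Or.inr (draconian_subdiv_increase hc (Or.inl rfl) h)
  · push Not at h
    obtain ⟨S, huS, hS⟩ := h
    exact Or.inl (draconian_subdiv_decrease he hc huS hS)
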